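/- Let U be a nonempty proper subset of V, set Ŵ = W_{U,U} and η̂_i = η_i + Σ_{j∈V∖U} W_{ij} for i ∈ U. For β_U ∈ D_U^{Ŵ} define the (V∖U)×(V∖U) matrix W̌(β_U) = W_{Uᶜ,Uᶜ} + W_{Uᶜ,U}·((H_β)_{U,U})^{-1}·W_{U,Uᶜ} and η̌(β_U) = η_{Uᶜ} + W_{Uᶜ,U}·((H_β)_{U,U})^{-1}·η_U, where (H_β)_{U,U} = 2·diag(β_U) − W_{U,U}. Then for every measurable f : ℝ^V → [0,∞], ∫ f dν_V^{W,η} = ∫_{ℝ^U} ( ∫_{ℝ^{V∖U}} f(β_U, β_{Uᶜ}) ν_{V∖U}^{W̌(β_U), η̌(β_U)}(dβ_{Uᶜ}) ) ν_U^{Ŵ,η̂}(dβ_U). -/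

import Mathlib

open MeasureTheory Matrix

noncomputable section

/-- The Schrödinger operator `H_β = 2·diag(β) − W`. -/
def Hmat {V : Type*} [Fintype V] [DecidableEq V] (W : Matrix V V ℝ) (β : V → ℝ) :
    Matrix V V ℝ :=
  2 • Matrix.diagonal β - W

/-- Density of the measure `ν_V^{W,η}` with respect to Lebesgue measure. -/
def nuDens {V : Type*} [Fintype V] [DecidableEq V] (W : Matrix V V ℝ) (η : V → ℝ)
    (β : V → ℝ) : ENNReal :=
  Set.indicator {β : V → ℝ | (Hmat W β).PosDef}
    (fun β => ENNReal.ofReal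
      ((2 / Real.pi) ^ ((Fintype.card V : ℝ) / 2) *
        Real.exp (-(1 / 2) * ((1 : V → ℝ) ⬝ᵥ (Hmat W β).mulVec 1
            + η ⬝ᵥ (Hmat W β)⁻¹.mulVec η) + η ⬝ᵥ (1 : V → ℝ)) /
        Real.sqrt (Hmat W β).det)) β

/-- The measure `ν_V^{W,η}`. -/
def nuMeas {V : Type*} [Fintype V] [DecidableEq V] (W : Matrix V V ℝ) (η : V → ℝ) :
    Measure (V → ℝ) :=
  volume.withDensity (nuDens W η)

/-- The graph on `V` with an edge `{i,j}` whenever `W i j > 0`. -/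
def graphOf {V : Type*} (W : Matrix V V ℝ) : SimpleGraph V :=
  SimpleGraph.fromRel (fun i j => 0 < W i j)


section helpers

variable {m n V : Type*} [Fintype m] [DecidableEq m] [Fintype n] [DecidableEq n]
  [Fintype V] [DecidableEq V]

lemma Hmat_apply (W : Matrix V V ℝ) (β : V → ℝ) (i j : V) :
    Hmat W β i j = (if i = j then 2 * β i else 0) - W i j := by
  by_cases h : i = j
  · subst h; simp [Hmat, two_smul, two_mul]
  · simp [Hmat, two_smul, h]

lemma nuDens_pos (W : Matrix V V ℝ) (η β : V → ℝ) (h : (Hmat W β).PosDef) :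
    nuDens W η β = ENNReal.ofReal
      ((2 / Real.pi) ^ ((Fintype.card V : ℝ) / 2) *
        Real.exp (-(1 / 2) * ((1 : V → ℝ) ⬝ᵥ (Hmat W β).mulVec 1
            + η ⬝ᵥ (Hmat W β)⁻¹.mulVec η) + η ⬝ᵥ (1 : V → ℝ)) /
        Real.sqrt (Hmat W β).det) := by
  unfold nuDens
  rw [Set.indicator_of_mem]
  simpa using h

lemma nuDens_neg (W : Matrix V V ℝ) (η β : V → ℝ) (h : ¬ (Hmat W β).PosDef) :
    nuDens W η β = 0 := by
  unfold nuDens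
  rw [Set.indicator_of_notMem]
  simpa using h

lemma posDef_block (A : Matrix m m ℝ) (B : Matrix m n ℝ) (D : Matrix n n ℝ) :
    (fromBlocks A (-B) (-Bᵀ) D).PosDef ↔ A.PosDef ∧ (D - Bᵀ * A⁻¹ * B).PosDef := by
  have key : A.PosDef → ((fromBlocks A (-B) (-Bᵀ) D).PosDef ↔ (D - Bᵀ * A⁻¹ * B).PosDef) := by
    intro hA
    let := hA.isUnit.invertible
    have h1 := PosDef.fromBlocks₁₁ (-B) D hA
    rw [conjTranspose_eq_transpose_of_trivial, transpose_neg] at h1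
    have e : D - -Bᵀ * A⁻¹ * -B = D - Bᵀ * A⁻¹ * B := by simp
    rw [e] at h1
    have h2 : (fromBlocks A (-B) (-Bᵀ) D).det = A.det * (D - Bᵀ * A⁻¹ * B).det := by
      rw [det_fromBlocks₁₁, invOf_eq_nonsing_inv, e]
    constructor
    · intro h
      have h3 := h1.1 h.posSemidef
      rw [h3.posDef_iff_det_ne_zero]
      have := h.det_pos
      rw [h2] at this
      intro h0
      simp [h0] at this
    · intro h
      have h3 := h1.2 h.posSemidef
      rw [h3.posDef_iff_det_ne_zero, h2]
      exact mul_ne_zero hA.det_pos.ne' h.det_pos.ne'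
  constructor
  · intro h
    have hA : A.PosDef := by
      have := h.submatrix (e := (Sum.inl : m → m ⊕ n)) Sum.inl_injective
      exact this
    exact ⟨hA, (key hA).1 h⟩
  · rintro ⟨hA, h⟩
    exact (key hA).2 h

lemma quad_inv_block (A : Matrix m m ℝ) (B : Matrix m n ℝ) (D : Matrix n n ℝ)
    (hA : A.PosDef) (hS : (D - Bᵀ * A⁻¹ * B).PosDef) (a : m → ℝ) (b : n → ℝ) :
    Sum.elim a b ⬝ᵥ (fromBlocks A (-B) (-Bᵀ) D)⁻¹ *ᵥ (Sum.elim a b) =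
      a ⬝ᵥ A⁻¹ *ᵥ a + (b + Bᵀ *ᵥ (A⁻¹ *ᵥ a)) ⬝ᵥ
        (D - Bᵀ * A⁻¹ * B)⁻¹ *ᵥ (b + Bᵀ *ᵥ (A⁻¹ *ᵥ a)) := by
  have hM := (posDef_block A B D).2 ⟨hA, hS⟩
  have hAu := (isUnit_iff_isUnit_det _).1 hA.isUnit
  have hSu := (isUnit_iff_isUnit_det _).1 hS.isUnit
  have hMu := (isUnit_iff_isUnit_det _).1 hM.isUnit
  set z := b + Bᵀ *ᵥ (A⁻¹ *ᵥ a) with hz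
  set y := (D - Bᵀ * A⁻¹ * B)⁻¹ *ᵥ z with hy
  have hSy : D *ᵥ y - Bᵀ *ᵥ (A⁻¹ *ᵥ (B *ᵥ y)) = z := by
    have : (D - Bᵀ * A⁻¹ * B) *ᵥ y = z := by
      rw [hy, mulVec_mulVec, mul_nonsing_inv _ hSu, one_mulVec]
    refine Eq.trans ?_ this
    rw [sub_mulVec, ← mulVec_mulVec, ← mulVec_mulVec]
  have hsol : (fromBlocks A (-B) (-Bᵀ) D) *ᵥ (Sum.elim (A⁻¹ *ᵥ (a + B *ᵥ y)) y) = Sum.elim a b := by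
    rw [fromBlocks_mulVec]
    congr 1
    · simp only [Sum.elim_comp_inl, Sum.elim_comp_inr]
      rw [mulVec_mulVec, mul_nonsing_inv _ hAu, one_mulVec, neg_mulVec]
      abel
    · simp only [Sum.elim_comp_inl, Sum.elim_comp_inr]
      rw [neg_mulVec, mulVec_add, mulVec_add]
      have : D *ᵥ y = z + Bᵀ *ᵥ (A⁻¹ *ᵥ (B *ᵥ y)) := by rw [← hSy]; abel
      rw [this, hz]; abel
  have hinv : (fromBlocks A (-B) (-Bᵀ) D)⁻¹ *ᵥ (Sum.elim a b) = Sum.elim (A⁻¹ *ᵥ (a + B *ᵥ y)) y := by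
    rw [← hsol, mulVec_mulVec, nonsing_inv_mul _ hMu, one_mulVec]
  rw [hinv, sumElim_dotProduct_sumElim, mulVec_add, dotProduct_add, hz, add_dotProduct]
  have hAt : A⁻¹ᵀ = A⁻¹ := by
    have := hA.inv.isHermitian
    rwa [IsHermitian, conjTranspose_eq_transpose_of_trivial] at this
  have : (Bᵀ *ᵥ (A⁻¹ *ᵥ a)) ⬝ᵥ y = a ⬝ᵥ A⁻¹ *ᵥ (B *ᵥ y) := by
    rw [mulVec_transpose, ← dotProduct_mulVec, ← hAt, mulVec_transpose, ← dotProduct_mulVec, hAt]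
  rw [this]; ring

lemma symm_quad (A : Matrix m m ℝ) (hA : A.PosDef) (x y : m → ℝ) :
    x ⬝ᵥ A⁻¹ *ᵥ y = y ⬝ᵥ A⁻¹ *ᵥ x := by
  have hAt : A⁻¹ᵀ = A⁻¹ := by
    have := hA.inv.isHermitian
    rwa [IsHermitian, conjTranspose_eq_transpose_of_trivial] at this
  rw [dotProduct_mulVec, dotProduct_comm, ← mulVec_transpose, hAt]

lemma Hmat_block (A : Matrix m m ℝ) (B : Matrix m n ℝ) (C : Matrix n n ℝ)
    (b1 : m → ℝ) (b2 : n → ℝ) :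
    Hmat (fromBlocks A B Bᵀ C) (Sum.elim b1 b2) =
      fromBlocks (Hmat A b1) (-B) (-Bᵀ) (Hmat C b2) := by
  ext (i | i) (j | j) <;> simp [Hmat_apply]

lemma dens_block (A : Matrix m m ℝ) (B : Matrix m n ℝ) (C : Matrix n n ℝ)
    (e1 b1 : m → ℝ) (e2 b2 : n → ℝ) :
    nuDens (fromBlocks A B Bᵀ C) (Sum.elim e1 e2) (Sum.elim b1 b2) =
      nuDens A (e1 + B *ᵥ 1) b1 *
      nuDens (C + Bᵀ * (Hmat A b1)⁻¹ * B) (e2 + Bᵀ *ᵥ ((Hmat A b1)⁻¹ *ᵥ e1)) b2 := by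
  have hS : Hmat (C + Bᵀ * (Hmat A b1)⁻¹ * B) b2 = Hmat C b2 - Bᵀ * (Hmat A b1)⁻¹ * B := by
    simp only [Hmat]; abel
  have hpd := posDef_block (Hmat A b1) B (Hmat C b2)
  rw [← Hmat_block] at hpd
  by_cases h1 : (Hmat A b1).PosDef
  swap
  · rw [nuDens_neg _ _ _ (fun h => h1 (hpd.1 h).1), nuDens_neg _ _ _ h1, zero_mul]
  by_cases h2 : (Hmat C b2 - Bᵀ * (Hmat A b1)⁻¹ * B).PosDef
  swap
  · rw [nuDens_neg _ _ _ (fun h => h2 (hpd.1 h).2), nuDens_neg _ _ b2 (by rwa [hS]), mul_zero]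
  rw [nuDens_pos _ _ _ (hpd.2 ⟨h1, h2⟩), nuDens_pos _ _ _ h1, nuDens_pos _ _ b2 (by rwa [hS]),
    hS, Hmat_block, ← ENNReal.ofReal_mul]
  swap
  · positivity
  rw [quad_inv_block _ _ _ h1 h2]
  have hdet : (fromBlocks (Hmat A b1) (-B) (-Bᵀ) (Hmat C b2)).det =
      (Hmat A b1).det * (Hmat C b2 - Bᵀ * (Hmat A b1)⁻¹ * B).det := by
    let := h1.isUnit.invertible
    rw [det_fromBlocks₁₁, invOf_eq_nonsing_inv]
    simp
  rw [hdet, Real.sqrt_mul h1.det_pos.le]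
  have hc : (2 / Real.pi) ^ ((Fintype.card (m ⊕ n) : ℝ) / 2) =
      (2 / Real.pi) ^ ((Fintype.card m : ℝ) / 2) * (2 / Real.pi) ^ ((Fintype.card n : ℝ) / 2) := by
    rw [← Real.rpow_add (by positivity), Fintype.card_sum]
    push_cast
    ring_nf
  rw [hc]
  have h11 : (1 : m ⊕ n → ℝ) = Sum.elim (1 : m → ℝ) (1 : n → ℝ) := by ext (i | i) <;> rfl
  generalize hq : (e2 + Bᵀ *ᵥ ((Hmat A b1)⁻¹ *ᵥ e1)) ⬝ᵥ
    (Hmat C b2 - Bᵀ * (Hmat A b1)⁻¹ * B)⁻¹ *ᵥ (e2 + Bᵀ *ᵥ ((Hmat A b1)⁻¹ *ᵥ e1)) = q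
  set H := Hmat A b1 with hH
  have t1 : (1 : m ⊕ n → ℝ) ⬝ᵥ (fromBlocks H (-B) (-Bᵀ) (Hmat C b2)) *ᵥ 1 =
      1 ⬝ᵥ H *ᵥ 1 - 2 * (1 ⬝ᵥ B *ᵥ 1) + 1 ⬝ᵥ Hmat C b2 *ᵥ 1 := by
    rw [h11, fromBlocks_mulVec, sumElim_dotProduct_sumElim]
    simp only [Sum.elim_comp_inl, Sum.elim_comp_inr, dotProduct_add, neg_mulVec, dotProduct_neg]
    have : (1 : n → ℝ) ⬝ᵥ Bᵀ *ᵥ 1 = 1 ⬝ᵥ B *ᵥ 1 := by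
      rw [mulVec_transpose, dotProduct_comm, ← dotProduct_mulVec]
    rw [this]; ring
  have t2 : (e1 + B *ᵥ 1) ⬝ᵥ H⁻¹ *ᵥ (e1 + B *ᵥ 1) = e1 ⬝ᵥ H⁻¹ *ᵥ e1 +
      2 * (e1 ⬝ᵥ H⁻¹ *ᵥ (B *ᵥ 1)) + (B *ᵥ 1) ⬝ᵥ H⁻¹ *ᵥ (B *ᵥ 1) := by
    rw [mulVec_add, dotProduct_add, add_dotProduct, add_dotProduct, symm_quad H h1 (B *ᵥ 1) e1]
    ring
  have t3 : (1 : n → ℝ) ⬝ᵥ (Hmat C b2 - Bᵀ * H⁻¹ * B) *ᵥ 1 = 1 ⬝ᵥ Hmat C b2 *ᵥ 1 -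
      (B *ᵥ 1) ⬝ᵥ H⁻¹ *ᵥ (B *ᵥ 1) := by
    rw [sub_mulVec, dotProduct_sub, ← mulVec_mulVec, ← mulVec_mulVec, mulVec_transpose,
      dotProduct_comm _ (_ ᵥ* _), ← dotProduct_mulVec, dotProduct_comm (H⁻¹ *ᵥ _)]
  have t4 : (e2 + Bᵀ *ᵥ (H⁻¹ *ᵥ e1)) ⬝ᵥ (1 : n → ℝ) = e2 ⬝ᵥ 1 + e1 ⬝ᵥ H⁻¹ *ᵥ (B *ᵥ 1) := by
    rw [add_dotProduct, mulVec_transpose, ← dotProduct_mulVec, dotProduct_comm (H⁻¹ *ᵥ _),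
      symm_quad H h1]
  have t5 : Sum.elim e1 e2 ⬝ᵥ (1 : m ⊕ n → ℝ) = e1 ⬝ᵥ 1 + e2 ⬝ᵥ 1 := by
    rw [h11, sumElim_dotProduct_sumElim]
  rw [t1, t2, t3, t4, t5, add_dotProduct, dotProduct_comm (B *ᵥ 1) 1]
  congr 1
  rw [div_mul_div_comm]
  congr 1
  rw [mul_mul_mul_comm, ← Real.exp_add]
  congr 2
  ring

lemma dens_reindex (e : m ≃ V) (W : Matrix V V ℝ) (η β : V → ℝ) :
    nuDens W η β = nuDens (W.submatrix e e) (η ∘ e) (β ∘ e) := by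
  have hH : Hmat (W.submatrix e e) (β ∘ e) = (Hmat W β).submatrix e e := by
    ext i j
    simp [Hmat_apply]
  have hpd : ((Hmat W β).submatrix e e).PosDef ↔ (Hmat W β).PosDef := by
    constructor
    · intro h
      have := h.submatrix (e := e.symm) e.symm.injective
      simpa using this
    · intro h
      exact h.submatrix e.injective
  have h1 : (1 : m → ℝ) = (1 : V → ℝ) ∘ e := rfl
  by_cases hp : (Hmat W β).PosDef
  swap
  · rw [nuDens_neg _ _ _ hp, nuDens_neg]
    rwa [hH, hpd]
  rw [nuDens_pos _ _ _ hp, nuDens_pos _ _ (β ∘ e) (by rwa [hH, hpd]), hH]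
  rw [Fintype.card_congr e, det_submatrix_equiv_self, inv_submatrix_equiv, submatrix_mulVec_equiv,
    submatrix_mulVec_equiv, h1]
  simp only [Function.comp_assoc, Equiv.self_comp_symm, Function.comp_id,
    comp_equiv_dotProduct_comp_equiv]

lemma continuous_Hmat (W : Matrix V V ℝ) : Continuous (fun β => Hmat W β) := by
  unfold Hmat
  fun_prop

lemma measurableSet_posDef (W : Matrix V V ℝ) :
    MeasurableSet {β : V → ℝ | (Hmat W β).PosDef} := by
  have : {β : V → ℝ | (Hmat W β).PosDef} =
      {β | (Hmat W β).IsHermitian ∧ ∀ x : V → ℝ, 0 ≤ star x ⬝ᵥ (Hmat W β) *ᵥ x} ∩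
        {β | (Hmat W β).det ≠ 0} := by
    ext β
    simp only [Set.mem_ofPred_eq, Set.mem_inter_iff, ← posSemidef_iff_dotProduct_mulVec]
    constructor
    · intro h; exact ⟨h.posSemidef, h.det_pos.ne'⟩
    · rintro ⟨h, h'⟩; exact h.posDef_iff_det_ne_zero.2 h'
  rw [this]
  have hc := continuous_Hmat W
  refine MeasurableSet.inter (IsClosed.measurableSet ?_) (IsOpen.measurableSet ?_)
  · refine IsClosed.and ?_ ?_
    · exact isClosed_eq (by fun_prop) hc
    · rw [Set.ofPred_forall]
      exact isClosed_iInter fun x => isClosed_le continuous_const (by fun_prop)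
  · exact isOpen_ne_fun (by fun_prop) continuous_const

lemma measurable_nuDens (W : Matrix V V ℝ) (η : V → ℝ) : Measurable (nuDens W η) := by
  have hc := continuous_Hmat W
  have hd : Measurable (fun β => (Hmat W β).det) := (hc.matrix_det).measurable
  have hinv : Measurable (fun β => η ⬝ᵥ (Hmat W β)⁻¹ *ᵥ η) := by
    have : (fun β => η ⬝ᵥ (Hmat W β)⁻¹ *ᵥ η) =
        fun β => ((Hmat W β).det)⁻¹ * (η ⬝ᵥ (Hmat W β).adjugate *ᵥ η) := by
      ext β
      rw [Matrix.inv_def, Ring.inverse_eq_inv', smul_mulVec, dotProduct_smul, smul_eq_mul]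
    rw [this]
    have h2 : Continuous fun β => η ⬝ᵥ (Hmat W β).adjugate *ᵥ η := by fun_prop
    exact hd.inv.mul h2.measurable
  have h1 : Measurable fun β => (1 : V → ℝ) ⬝ᵥ (Hmat W β) *ᵥ 1 := by
    have : Continuous fun β => (1 : V → ℝ) ⬝ᵥ (Hmat W β) *ᵥ 1 := by fun_prop
    exact this.measurable
  have : nuDens W η = Set.indicator {β : V → ℝ | (Hmat W β).PosDef}
    (fun β => ENNReal.ofReal
      ((2 / Real.pi) ^ ((Fintype.card V : ℝ) / 2) *
        Real.exp (-(1 / 2) * ((1 : V → ℝ) ⬝ᵥ (Hmat W β).mulVec 1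
            + η ⬝ᵥ (Hmat W β)⁻¹.mulVec η) + η ⬝ᵥ (1 : V → ℝ)) /
        Real.sqrt (Hmat W β).det)) := by
    ext β; rfl
  rw [this]
  refine Measurable.indicator ?_ (measurableSet_posDef W)
  fun_prop

lemma nuDens_lt_top (W : Matrix V V ℝ) (η β : V → ℝ) : nuDens W η β < ⊤ := by
  by_cases h : (Hmat W β).PosDef
  · rw [nuDens_pos _ _ _ h]; exact ENNReal.ofReal_lt_top
  · rw [nuDens_neg _ _ _ h]; simp

lemma lintegral_nuMeas (W : Matrix V V ℝ) (η : V → ℝ) (g : (V → ℝ) → ENNReal) :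
    ∫⁻ β, g β ∂(nuMeas W η) = ∫⁻ β, nuDens W η β * g β := by
  unfold nuMeas
  rw [lintegral_withDensity_eq_lintegral_mul_non_measurable _ (measurable_nuDens W η)
    (Filter.Eventually.of_forall fun β => nuDens_lt_top W η β)]
  rfl

/-- The splitting of `V` into `U` and its complement. -/
def splitEquiv (U : Finset V) : ↥U ⊕ ↥(Uᶜ) ≃ V where
  toFun := Sum.elim (fun i => i.1) (fun i => i.1)
  invFun i := if h : i ∈ U then Sum.inl ⟨i, h⟩ else Sum.inr ⟨i, Finset.mem_compl.mpr h⟩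
  left_inv := by
    rintro (⟨i, hi⟩ | ⟨i, hi⟩)
    · simp [hi]
    · have := Finset.mem_compl.mp hi
      simp [this]
  right_inv i := by
    by_cases h : i ∈ U <;> simp [h]

lemma lintegral_split (U : Finset V) (F : (V → ℝ) → ENNReal) (hF : Measurable F) :
    ∫⁻ β, F β = ∫⁻ b1 : ↥U → ℝ, ∫⁻ b2 : ↥(Uᶜ) → ℝ,
      F (fun i => if h : i ∈ U then b1 ⟨i, h⟩ else b2 ⟨i, Finset.mem_compl.mpr h⟩) := by
  have hp1 := volume_measurePreserving_piCongrLeft (fun _ : V => ℝ) (splitEquiv U)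
  have hp2 := volume_measurePreserving_sumPiEquivProdPi_symm (fun _ : ↥U ⊕ ↥(Uᶜ) => ℝ)
  have hp := hp1.comp hp2
  rw [← hp.lintegral_comp hF]
  have hG := hF.comp hp.measurable
  rw [show (volume : Measure ((↥U → ℝ) × (↥(Uᶜ) → ℝ))) = volume.prod volume from rfl]
  refine (lintegral_prod _ hG.aemeasurable).trans ?_
  refine lintegral_congr fun b1 => lintegral_congr fun b2 => ?_
  refine congrArg F (funext fun i => ?_)
  obtain ⟨j, rfl⟩ := (splitEquiv U).surjective i
  simp only [Function.comp_apply]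
  erw [MeasurableEquiv.piCongrLeft_apply_apply]
  rcases j with ⟨j, hj⟩ | ⟨j, hj⟩
  · simp [splitEquiv, hj, MeasurableEquiv.sumPiEquivProdPi, Equiv.sumPiEquivProdPi]
  · have := Finset.mem_compl.mp hj
    simp [splitEquiv, this, MeasurableEquiv.sumPiEquivProdPi, Equiv.sumPiEquivProdPi]

end helpers

theorem stmt4 {V : Type*} [Fintype V] [DecidableEq V] [Nonempty V]
    (W : Matrix V V ℝ) (hsymm : W.IsSymm) (hnn : ∀ i j, 0 ≤ W i j)
    (hdiag : ∀ i, W i i = 0) (hconn : (graphOf W).Connected)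
    (η : V → ℝ) (hη : ∀ i, 0 ≤ η i)
    (U : Finset V) (hU : U.Nonempty) (hUproper : U ≠ Finset.univ)
    (f : (V → ℝ) → ENNReal) (hf : Measurable f) :
    ∫⁻ β, f β ∂(nuMeas W η)
      = ∫⁻ βU : ↥U → ℝ,
          (∫⁻ βc : ↥(Uᶜ) → ℝ,
            f (fun i => if h : i ∈ U then βU ⟨i, h⟩ else βc ⟨i, Finset.mem_compl.mpr h⟩)
            ∂(nuMeas
                (Matrix.of fun i j : ↥(Uᶜ) => W i.1 j.1
                  + ∑ a : ↥U, ∑ b : ↥U,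
                      W i.1 a.1 * (Hmat (Matrix.of fun a b : ↥U => W a.1 b.1) (fun a => βU a))⁻¹ a b * W b.1 j.1)
                (fun i : ↥(Uᶜ) => η i.1
                  + ∑ a : ↥U, ∑ b : ↥U,
                      W i.1 a.1 * (Hmat (Matrix.of fun a b : ↥U => W a.1 b.1) (fun a => βU a))⁻¹ a b * η b.1)))
          ∂(nuMeas (Matrix.of fun i j : ↥U => W i.1 j.1)
              (fun i : ↥U => η i.1 + ∑ j ∈ Uᶜ, W i.1 j)) := by
  rw [lintegral_nuMeas, lintegral_nuMeas, lintegral_split U (fun β => nuDens W η β * f β)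
    ((measurable_nuDens W η).mul hf)]
  refine lintegral_congr fun b1 => ?_
  rw [lintegral_nuMeas, ← lintegral_const_mul' _ _ (nuDens_lt_top _ _ _).ne]
  refine lintegral_congr fun b2 => ?_
  rw [← mul_assoc]
  congr 1
  rw [dens_reindex (splitEquiv U)]
  have h := dens_block (Matrix.of fun a b : ↥U => W a.1 b.1)
    (Matrix.of fun (a : ↥U) (b : ↥(Uᶜ)) => W a.1 b.1)
    (Matrix.of fun a b : ↥(Uᶜ) => W a.1 b.1) (fun i => η i.1) b1 (fun i => η i.1) b2
  convert! h using 2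
  · ext (i | i) (j | j)
    · simp [splitEquiv]
    · simp [splitEquiv]
    · simp [splitEquiv, hsymm.apply]
    · simp [splitEquiv]
  · ext (i | i) <;> simp [splitEquiv]
  · ext (i | i)
    · simp [splitEquiv]
    · have := Finset.mem_compl.mp i.2
      simp [splitEquiv, this]
  · congr 1
    ext i
    simp [mulVec, dotProduct]
    exact (Finset.sum_attach Uᶜ (fun j => W i.1 j)).symm
  · congr 1
    · ext i j
      simp only [of_apply, Matrix.add_apply, mul_apply, transpose_apply, Finset.sum_mul]
      rw [Finset.sum_comm]
      simp [hsymm.apply]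
    · ext i
      simp only [Pi.add_apply, mulVec, dotProduct, transpose_apply, of_apply, Finset.mul_sum, mul_assoc]
      simp [hsymm.apply]

end
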